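/- arXiv:1903.04266 — 2 statements merged into one kernel-verified Lean document; each statement's English description precedes it below -/
import Mathlib

section
/- Let k be an uncountable field that is not algebraic over a finite subfield, and let R be a k-algebra that is noncommutative modulo its Jacobson radical (i.e., the quotient of R by its Jacobson radical is noncommutative). Then R contains a free noncyclic subsemigroup. -/
universe u v

/-- A ring (or semigroup) `R` contains a free noncyclic subsemigroup if there
are `x y : R` such that the multiplicative subsemigroup they generate is free
on `{x, y}`, i.e. the canonical semigroup homomorphism from the free semigroup
on two generators sending the generators to `x` and `y` is injective. -/
def HasFreeNoncyclicSubsemigroup (R : Type*) [Semigroup R] : Prop :=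
  ∃ x y : R, Function.Injective
    ⇑(FreeSemigroup.lift (fun b : Bool => if b then x else y))

/-- A field `k` is not algebraic over a finite subfield if there is no finite
subfield `F` of `k` such that every element of `k` is algebraic over `F`. -/
def NotAlgebraicOverFiniteSubfield (k : Type*) [Field k] : Prop :=
  ¬ ∃ F : Subfield k, Finite F ∧ ∀ x : k, IsAlgebraic F x

/-- `r` lies in the Jacobson radical of the ring `R`: it annihilates every
simple left `R`-module. -/
def InJacobsonRadical {R : Type u} [Ring R] (r : R) : Prop :=
  ∀ (M : Type u) (_ : AddCommGroup M) (_ : Module R M),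
    IsSimpleModule R M → ∀ m : M, r • m = 0

open Polynomial

theorem FreeSemigroup.lift_eq_prod_map {α M : Type*} [Monoid M] (f : α → M)
    (w : FreeSemigroup α) : FreeSemigroup.lift f w = ((w.head :: w.tail).map f).prod := by
  induction w using FreeSemigroup.recOnMul with
  | ih1 x => simp
  | ih2 x y _ ih => simp [ih]

/-- Two elements freely generating a submonoid freely generate a subsemigroup. -/
theorem HasFreeNoncyclicSubsemigroup.of_injective_prod_map {R : Type*} [Monoid R] (f : Bool → R)
    (hf : Function.Injective fun l : List Bool => (l.map f).prod) :
    HasFreeNoncyclicSubsemigroup R := by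
  have hfun : (fun b : Bool => if b then f true else f false) = f := by
    funext b; cases b <;> rfl
  refine ⟨f true, f false, fun w w' h => ?_⟩
  rw [hfun, FreeSemigroup.lift_eq_prod_map, FreeSemigroup.lift_eq_prod_map] at h
  have := hf h
  simp only [List.cons.injEq] at this
  exact FreeSemigroup.ext this.1 this.2

section Specialization

variable {k R : Type*} [Field k] [Ring R] [Algebra k R]

variable (R) in
/-- Evaluation of polynomials with noncommuting coefficients at a central scalar. -/
noncomputable def evalScalar (c : k) : R[X] →+* R :=
  eval₂RingHom' (RingHom.id R) (algebraMap k R c) fun a => (Algebra.commutes c a).symm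

theorem finite_setOf_evalScalar_eq_zero {P : R[X]} (hP : P ≠ 0) :
    {c : k | evalScalar R c P = 0}.Finite := by
  obtain ⟨n, hn⟩ : ∃ n, P.coeff n ≠ 0 := by
    by_contra! h
    exact hP (Polynomial.ext (by simpa using h))
  obtain ⟨φ, hφ⟩ := Module.Projective.exists_dual_ne_zero k hn
  let Q : k[X] := ∑ i ∈ Finset.range (P.natDegree + 1), C (φ (P.coeff i)) * X ^ i
  have hQ : Q ≠ 0 := by
    intro h
    have hcoeff := congrArg (coeff · n) h
    have hle : n < P.natDegree + 1 := Nat.lt_succ_of_le (le_natDegree_of_ne_zero hn)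
    simp [Q, coeff_C_mul, coeff_X_pow, hle] at hcoeff
    exact hφ hcoeff
  have heval (c : k) : Q.eval c = φ (evalScalar R c P) := by
    change _ = φ (eval₂ (RingHom.id R) (algebraMap k R c) P)
    rw [eval₂_eq_sum_range, map_sum, eval_finsetSum]
    refine Finset.sum_congr rfl fun i _ => ?_
    rw [← map_pow, RingHom.id_apply, ← Algebra.commutes, ← Algebra.smul_def, map_smul]
    rw [eval_mul, eval_C, eval_pow, eval_X, smul_eq_mul, mul_comm]
  refine (finite_setOfPred_isRoot hQ).subset fun c hc => ?_
  have hc : evalScalar R c P = 0 := hc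
  rw [Set.mem_ofPred_eq, IsRoot, heval, hc, map_zero]

theorem exists_forall_evalScalar_ne_zero [Uncountable k] {ι : Type*} [Countable ι]
    (P : ι → R[X]) (hP : ∀ i, P i ≠ 0) : ∃ c : k, ∀ i, evalScalar R c (P i) ≠ 0 := by
  have hcount : (⋃ i, {c : k | evalScalar R c (P i) = 0}).Countable :=
    Set.countable_iUnion fun i => (finite_setOf_evalScalar_eq_zero (hP i)).countable
  by_contra! h
  refine Set.not_countable_univ (α := k) (hcount.mono fun c _ => ?_)
  simpa using h c

theorem exists_injective_prod_map_of_polynomial [Uncountable k] (f : Bool → R[X])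
    (hf : Function.Injective fun l : List Bool => (l.map f).prod) :
    ∃ g : Bool → R, Function.Injective fun l : List Bool => (l.map g).prod := by
  obtain ⟨c, hc⟩ := exists_forall_evalScalar_ne_zero (k := k)
    (fun p : {p : List Bool × List Bool // p.1 ≠ p.2} =>
      (p.1.1.map f).prod - (p.1.2.map f).prod)
    (fun p h => p.2 (hf (sub_eq_zero.mp h)))
  refine ⟨fun b => evalScalar R c (f b), fun l l' h => ?_⟩
  by_contra hne
  apply hc ⟨(l, l'), hne⟩
  rw [map_sub, map_list_prod, map_list_prod, List.map_map, List.map_map]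
  exact sub_eq_zero.mpr h

end Specialization

section Word

variable (k : Type*) [Field k]

/-- The image of `0` under a word in the affine maps `z ↦ X * z + 1` (for `true`) and
`z ↦ X ^ 2 * z + X` (for `false`). -/
noncomputable def wordPoly : List Bool → k[X]
  | [] => 0
  | true :: l => X * wordPoly l + 1
  | false :: l => X * (X * wordPoly l + 1)

theorem wordPoly_injective : Function.Injective (wordPoly k) := by
  have aux (p : k[X]) : X * p + 1 ≠ 0 := fun h => by simpa using congrArg (coeff · 0) h
  have aux' (p q : k[X]) : X * p + 1 ≠ X * q := fun h => by simpa using congrArg (coeff · 0) h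
  intro l
  induction l with
  | nil =>
    rintro (_ | ⟨_ | _, l'⟩) h
    · rfl
    · exact absurd h.symm (mul_ne_zero X_ne_zero (aux _))
    · exact absurd h.symm (aux _)
  | cons b l ih =>
    rintro (_ | ⟨b', l'⟩) h
    · cases b
      · exact absurd h (mul_ne_zero X_ne_zero (aux _))
      · exact absurd h (aux _)
    · cases b <;> cases b' <;> simp only [wordPoly] at h
      · rw [ih (mul_left_cancel₀ X_ne_zero (add_right_cancel (mul_left_cancel₀ X_ne_zero h)))]
      · exact absurd h.symm (aux' _ _)
      · exact absurd h (aux' _ _)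
      · rw [ih (mul_left_cancel₀ X_ne_zero (add_right_cancel h))]

theorem exists_injective_eval_wordPoly [Uncountable k] :
    ∃ t : k, Function.Injective fun l => (wordPoly k l).eval t := by
  obtain ⟨t, ht⟩ := exists_forall_evalScalar_ne_zero (k := k)
    (fun p : {p : List Bool × List Bool // p.1 ≠ p.2} => wordPoly k p.1.1 - wordPoly k p.1.2)
    (fun p h => p.2 (wordPoly_injective k (sub_eq_zero.mp h)))
  refine ⟨t, fun l l' h => ?_⟩
  by_contra hne
  apply ht ⟨(l, l'), hne⟩
  rw [map_sub]
  exact sub_eq_zero.mpr h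

end Word

section Simple

variable {S M : Type*} [Ring S] [AddCommGroup M] [Module S M] [IsSimpleModule S M]

theorem IsSimpleModule.exists_smul_eq_zero_and_smul_eq {v w : M} (hv : v ≠ 0)
    (hw : ∀ φ : Module.End S M, φ v ≠ w) (a : M) : ∃ s : S, s • v = 0 ∧ s • w = a := by
  have hsurj := IsSimpleModule.toSpanSingleton_surjective S hv
  obtain ⟨s, hsv, hsw⟩ : ∃ s : S, s • v = 0 ∧ s • w ≠ 0 := by
    by_contra! h
    let e := (LinearMap.toSpanSingleton S M v).quotKerEquivOfSurjective hsurj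
    have hker : LinearMap.ker (LinearMap.toSpanSingleton S M v) ≤
        LinearMap.ker (LinearMap.toSpanSingleton S M w) := fun s hs => h s hs
    refine hw ((Submodule.liftQ _ (LinearMap.toSpanSingleton S M w) hker) ∘ₗ e.symm.toLinearMap) ?_
    have he : e (Submodule.Quotient.mk 1) = v := by
      change LinearMap.toSpanSingleton S M v 1 = v
      simp
    have : e.symm v = Submodule.Quotient.mk 1 := e.symm_apply_eq.mpr he.symm
    simp [this]
  obtain ⟨r, hr⟩ := IsSimpleModule.toSpanSingleton_surjective S hsw a
  exact ⟨r * s, by rw [mul_smul, hsv, smul_zero], by rw [mul_smul]; exact hr⟩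

theorem IsSimpleModule.forall_end_apply_ne_symm {v w : M} (hv : v ≠ 0)
    (hw : ∀ φ : Module.End S M, φ v ≠ w) (φ : Module.End S M) : φ w ≠ v := by
  rintro rfl
  have hbij := LinearMap.bijective_of_ne_zero (f := φ) (by rintro rfl; exact hv rfl)
  exact hw (LinearEquiv.ofBijective φ hbij).symm.toLinearMap
    ((LinearEquiv.ofBijective φ hbij).symm_apply_apply w)

theorem IsSimpleModule.exists_injective_prod_map {k : Type*} [Field k] [Uncountable k] [Algebra k S]
    {v w : M} (hv : v ≠ 0) (hw : ∀ φ : Module.End S M, φ v ≠ w) :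
    ∃ f : Bool → S, Function.Injective fun l : List Bool => (l.map f).prod := by
  have hw0 : w ≠ 0 := fun h => hw 0 (by simp [h])
  obtain ⟨e₁, h₁w, h₁v⟩ := exists_smul_eq_zero_and_smul_eq (S := S) hw0
    (forall_end_apply_ne_symm hv hw) v
  obtain ⟨e₂, h₂v, h₂w⟩ := exists_smul_eq_zero_and_smul_eq (S := S) hv hw w
  obtain ⟨n, hnv, hnw⟩ := exists_smul_eq_zero_and_smul_eq (S := S) hv hw v
  obtain ⟨t, ht⟩ := exists_injective_eval_wordPoly k
  let _ : Module k M := Module.compHom M (algebraMap k S)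
  have _ : IsScalarTower k S M := ⟨fun c s m => by
    rw [Algebra.smul_def, mul_smul]; rfl⟩
  have _ : SMulCommClass k S M := IsScalarTower.to_smulCommClass
  refine ⟨fun b => if b then t • e₁ + e₂ + n else t ^ 2 • e₁ + e₂ + t • n, fun l l' h => ?_⟩
  have key (l : List Bool) : (l.map fun b => if b then t • e₁ + e₂ + n else
      t ^ 2 • e₁ + e₂ + t • n).prod • w = w + (wordPoly k l).eval t • v := by
    induction l with
    | nil => simp [wordPoly]
    | cons b l ih =>
      rw [List.map_cons, List.prod_cons, mul_smul, ih]
      cases b <;>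
      · simp only [wordPoly, add_smul, smul_add, smul_assoc, smul_comm _ (eval t (wordPoly k l)),
          h₁w, h₁v, h₂v, h₂w, hnv, hnw, smul_zero, eval_add, eval_mul, eval_X, eval_one, mul_add,
          if_true, Bool.false_eq_true, if_false]
        module
  apply ht
  have hk := congrArg (· • w) h
  simp only [key, add_right_inj] at hk
  exact smul_left_injective k hv hk

end Simple

/-- A simple module on which a commutator acts nontrivially stays simple over the polynomial ring
for some action of the variable making it more than one-dimensional over its endomorphisms. -/
theorem exists_end_forall_commute_apply_ne {R M : Type*} [Ring R] [AddCommGroup M] [Module R M]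
    [IsSimpleModule R M] {x y : R} {m : M} (h : (x * y - y * x) • m ≠ 0) :
    ∃ (δ : Module.End R M) (v w : M), v ≠ 0 ∧ ∀ φ : Module.End R M, Commute φ δ → φ v ≠ w := by
  have hm : m ≠ 0 := by rintro rfl; simp at h
  by_cases hall : ∀ w, ∃ φ : Module.End R M, φ m = w
  · obtain ⟨φ, hφ⟩ := hall (x • m)
    obtain ⟨ψ, hψ⟩ := hall (y • m)
    refine ⟨φ, m, y • m, hm, fun χ hχ hχm => h ?_⟩
    have hχψ : χ m = y • m := hχm
    rw [sub_smul, sub_eq_zero, mul_smul, mul_smul, ← hχm, ← map_smul, ← hφ]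
    have := LinearMap.congr_fun hχ.eq m
    rw [Module.End.mul_apply, Module.End.mul_apply] at this
    rw [this, hχψ, map_smul]
  · push Not at hall
    obtain ⟨w, hw⟩ := hall
    exact ⟨1, m, w, hm, fun φ _ => hw φ⟩

theorem exists_injective_prod_map_polynomial (k : Type*) {R M : Type*} [Field k] [Uncountable k]
    [Ring R] [Algebra k R] [AddCommGroup M] [Module R M] [IsSimpleModule R M]
    {x y : R} {m : M} (h : (x * y - y * x) • m ≠ 0) :
    ∃ f : Bool → R[X], Function.Injective fun l : List Bool => (l.map f).prod := by
  obtain ⟨δ, v, w, hv, hw⟩ := exists_end_forall_commute_apply_ne h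
  let ρ : R[X] →+* AddMonoid.End M :=
    eval₂RingHom' (Module.toAddMonoidEnd R M) δ.toAddMonoidHom fun a => by
      ext m
      exact (map_smul δ a m).symm
  let _ : Module R[X] M := Module.compHom M ρ
  have hC (r : R) (m : M) : (C r : R[X]) • m = r • m :=
    DFunLike.congr_fun (eval₂_C (Module.toAddMonoidEnd R M) _) m
  have hX (m : M) : (X : R[X]) • m = δ m :=
    DFunLike.congr_fun (eval₂_X (Module.toAddMonoidEnd R M) _) m
  have _ : IsSimpleModule R[X] M := by
    rw [isSimpleModule_iff_toSpanSingleton_surjective]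
    refine ⟨IsSimpleModule.nontrivial R M, fun m hm a => ?_⟩
    obtain ⟨r, hr⟩ := IsSimpleModule.toSpanSingleton_surjective R hm a
    exact ⟨C r, (hC r m).trans hr⟩
  refine IsSimpleModule.exists_injective_prod_map (S := R[X]) (k := k) hv (w := w) fun φ => ?_
  let φ' : Module.End R M :=
    { φ.toAddMonoidHom with
      map_smul' := fun r m => by
        have := map_smul φ (C r) m
        rwa [hC, hC] at this }
  refine hw φ' (LinearMap.ext fun m => ?_)
  have := map_smul φ (X : R[X]) m
  rwa [hX, hX] at this

/-- If `k` is an uncountable field not algebraic over a finite subfield and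
the `k`-algebra `R` is noncommutative modulo its Jacobson radical, then `R`
contains a free noncyclic subsemigroup. -/
theorem free_subsemigroup_of_uncountable_noncomm_mod_jacobson
    {k : Type v} [Field k] [Uncountable k] (hk : NotAlgebraicOverFiniteSubfield k)
    {R : Type u} [Ring R] [Algebra k R]
    (hnc : ∃ x y : R, ¬ InJacobsonRadical (x * y - y * x)) :
    HasFreeNoncyclicSubsemigroup R := by
  obtain ⟨x, y, hxy⟩ := hnc
  unfold InJacobsonRadical at hxy
  push Not at hxy
  obtain ⟨M, _, _, _, m, hm⟩ := hxy
  obtain ⟨f, hf⟩ := exists_injective_prod_map_polynomial k hm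
  obtain ⟨g, hg⟩ := exists_injective_prod_map_of_polynomial (k := k) f hf
  exact .of_injective_prod_map g hg
end

section
/- Let k be a field that is not algebraic over a finite subfield, let K be a field extension of k, and let R be a noncommutative central simple K-algebra that is finite dimensional over K. Then the group of units of R contains a free noncyclic subgroup. -/
/-- A group `G` contains a free noncyclic subgroup if there are `x y : G`
such that the subgroup they generate is free on `{x, y}`, i.e. the canonical
group homomorphism from the free group on two generators sending the
generators to `x` and `y` is injective. -/
def HasFreeNoncyclicSubgroup (G : Type*) [Group G] : Prop :=
  ∃ x y : G, Function.Injective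
    ⇑(FreeGroup.lift (fun b : Bool => if b then x else y))

open scoped TensorProduct
open Matrix Polynomial

theorem exists_algHom_matrix_span_eq_top (K Ω R : Type*) [Field K] [Field Ω] [IsAlgClosed Ω]
    [Algebra K Ω] [Ring R] [Nontrivial R] [Algebra K R] [Module.Finite K R] :
    ∃ (n : ℕ) (ρ : R →ₐ[K] Matrix (Fin n) (Fin n) Ω), n ≠ 0 ∧
      Submodule.span Ω (Set.range ρ) = ⊤ := by
  let B := Ω ⊗[K] R
  have : IsArtinianRing B := IsArtinianRing.of_finite Ω B
  let Q := B ⧸ Ring.jacobson B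
  have hQ : IsSemisimpleRing Q := inferInstance
  have : Module.Finite Ω Q := inferInstance
  have : Nontrivial Q := Ideal.Quotient.nontrivial_iff.mpr (Ring.jacobson_lt_top B).ne
  obtain ⟨m, d, hd, ⟨e⟩⟩ := IsSemisimpleRing.exists_algEquiv_pi_matrix_of_isAlgClosed Ω Q
  obtain rfl | ⟨m, rfl⟩ : m = 0 ∨ ∃ k, m = k + 1 := by cases m <;> simp
  · exact (not_subsingleton Q e.toEquiv.subsingleton).elim
  let f : B →ₐ[Ω] Matrix (Fin (d 0)) (Fin (d 0)) Ω :=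
    (Pi.evalAlgHom Ω (fun i => Matrix (Fin (d i)) (Fin (d i)) Ω) 0).comp
      (e.toAlgHom.comp (Ideal.Quotient.mkₐ Ω (Ring.jacobson B)))
  have hf : Function.Surjective f :=
    (Function.surjective_eval 0).comp (e.surjective.comp Ideal.Quotient.mk_surjective)
  refine ⟨d 0, (f.restrictScalars K).comp Algebra.TensorProduct.includeRight, (hd 0).ne, ?_⟩
  rw [eq_top_iff]
  rintro M -
  obtain ⟨b, rfl⟩ := hf M
  induction b using TensorProduct.induction_on with
  | zero => simp
  | tmul ω r =>
    have : (ω ⊗ₜ[K] r : B) = ω • (1 ⊗ₜ[K] r) := by simp [TensorProduct.smul_tmul']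
    rw [this, map_smul]
    exact Submodule.smul_mem _ _ (Submodule.subset_span ⟨r, rfl⟩)
  | add x y hx hy => rw [map_add]; exact add_mem hx hy


theorem exists_eval_entries_ne_zero {K Ω R ι n : Type*} [Field K] [Infinite K] [Field Ω]
    [Algebra K Ω] [Ring R] [Algebra K R] [Module.Finite K R] [Fintype n] [DecidableEq n]
    (ρ : R →ₐ[K] Matrix n n Ω) (hρ : Submodule.span Ω (Set.range ρ) = ⊤)
    (p : MvPolynomial (ι × n × n) Ω) (M : ι → Matrix n n Ω)
    (hM : MvPolynomial.eval (fun t => M t.1 t.2.1 t.2.2) p ≠ 0) :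
    ∃ r : ι → R, MvPolynomial.eval (fun t => ρ (r t.1) t.2.1 t.2.2) p ≠ 0 := by
  let b := Module.finBasis K R
  have hspan : Submodule.span Ω (Set.range (ρ ∘ b)) = ⊤ := by
    rw [eq_top_iff, ← hρ, Submodule.span_le]
    rintro _ ⟨r, rfl⟩
    rw [← b.sum_repr r, map_sum]
    refine sum_mem fun i _ => ?_
    rw [map_smul, ← algebraMap_smul Ω (b.repr r i)]
    exact Submodule.smul_mem _ _ (Submodule.subset_span ⟨i, rfl⟩)
  have hcoord : ∀ i, ∃ ω : Fin (Module.finrank K R) → Ω, ∑ j, ω j • ρ (b j) = M i := fun i =>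
    (Submodule.mem_span_range_iff_exists_fun Ω).mp (hspan ▸ Submodule.mem_top)
  choose ω hω using hcoord
  let q : MvPolynomial (ι × Fin (Module.finrank K R)) Ω :=
    MvPolynomial.bind₁ (fun t => ∑ j, MvPolynomial.X (t.1, j) *
      MvPolynomial.C (ρ (b j) t.2.1 t.2.2)) p
  have hq : ∀ y, MvPolynomial.eval y q =
      MvPolynomial.eval (fun t => (∑ j, y (t.1, j) • ρ (b j)) t.2.1 t.2.2) p := by
    intro y
    simp only [q]
    rw [← MvPolynomial.aeval_eq_eval, MvPolynomial.aeval_bind₁, ← MvPolynomial.aeval_eq_eval]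
    simp [Matrix.sum_apply]
  have hq0 : q ≠ 0 := by
    intro h
    apply hM
    have := hq (fun t => ω t.1 t.2)
    simpa [h, hω] using this.symm
  by_contra! h
  refine hq0 (MvPolynomial.funext_set (fun _ => Set.range (algebraMap K Ω))
    (fun _ => Set.infinite_range_of_injective (algebraMap K Ω).injective) fun x hx => ?_)
  choose y hy using fun t => hx t trivial
  rw [hq, map_zero, ← h fun i => ∑ j, y (i, j) • b j]
  simp [← hy, map_sum, algebraMap_smul]

theorem exists_algEquiv_apply_eq_diagonal {Ω n : Type*} [Field Ω] [IsAlgClosed Ω] [Fintype n]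
    [DecidableEq n] (M : Matrix n n Ω) (hM : M.charpoly.roots.Nodup) :
    ∃ (φ : Matrix n n Ω ≃ₐ[Ω] Matrix n n Ω) (α : n → Ω),
      Function.Injective α ∧ φ M = diagonal α := by
  classical
  have hcard : M.charpoly.roots.toFinset.card = Fintype.card n := by
    rw [Multiset.toFinset_card_of_nodup hM, ← M.charpoly_natDegree_eq_dim,
      (IsAlgClosed.splits M.charpoly).natDegree_eq_card_roots]
  let e : n ≃ M.charpoly.roots.toFinset := Fintype.equivOfCardEq (by simp [hcard])
  let α : n → Ω := fun i => e i
  have hα : Function.Injective α := Subtype.val_injective.comp e.injective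
  have hev : ∀ i, Module.End.HasEigenvalue (Matrix.toLinAlgEquiv' M) (α i) := by
    intro i
    have h := (Multiset.mem_toFinset.mp (e i).2)
    have h' : (α i) ∈ spectrum Ω M :=
      Matrix.mem_spectrum_iff_isRoot_charpoly.mpr (isRoot_of_mem_roots h)
    rw [Module.End.hasEigenvalue_iff_mem_spectrum, AlgEquiv.spectrum_eq]
    exact h'
  choose v hv using fun i => (hev i).exists_hasEigenvector
  have hli : LinearIndependent Ω v :=
    Module.End.eigenvectors_linearIndependent' _ α hα v hv
  let B := basisOfLinearIndependentOfCardEqFinrank' v hli (by simp)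
  refine ⟨Matrix.toLinAlgEquiv'.trans (LinearMap.toMatrixAlgEquiv B), α, hα, ?_⟩
  ext i j
  have hB : B j = v j := by simp [B]
  rw [AlgEquiv.trans_apply, LinearMap.toMatrixAlgEquiv_apply, hB, (hv j).apply_eq_smul, ← hB]
  simp [Finsupp.single_apply, diagonal_apply, eq_comm]
  aesop

theorem exists_algHom_apply_eq_diagonal {K Ω R n : Type*} [Field K] [Infinite K] [Field Ω]
    [IsAlgClosed Ω] [Algebra K Ω] [Ring R] [Algebra K R] [Module.Finite K R] [Fintype n]
    [DecidableEq n] (ρ : R →ₐ[K] Matrix n n Ω) (hρ : Submodule.span Ω (Set.range ρ) = ⊤) :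
    ∃ (ρ' : R →ₐ[K] Matrix n n Ω) (a : R) (α : n → Ω),
      Submodule.span Ω (Set.range ρ') = ⊤ ∧ Function.Injective α ∧ ρ' a = diagonal α := by
  have : Infinite Ω := Infinite.of_injective _ (algebraMap K Ω).injective
  let G : Matrix n n (MvPolynomial (Unit × n × n) Ω) :=
    Matrix.of fun i j => MvPolynomial.X ((), i, j)
  let N := Fintype.card n
  let p := G.charpoly.resultant (derivative G.charpoly) N N
  have hp : ∀ M : Unit → Matrix n n Ω, MvPolynomial.eval (fun t => M t.1 t.2.1 t.2.2) p =
      ((M ()).charpoly.roots.map (derivative (M ()).charpoly).eval).prod := by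
    intro M
    have hX : G.map (MvPolynomial.eval (fun t => M t.1 t.2.1 t.2.2)) = M () := by
      ext i j; simp [G]
    have hd : (derivative (M ()).charpoly).natDegree ≤ N :=
      (natDegree_derivative_le _).trans (by
        rw [(M ()).charpoly_natDegree_eq_dim]; exact Nat.sub_le _ _)
    have h := resultant_eq_prod_eval (M ()).charpoly (derivative (M ()).charpoly) N hd
      (IsAlgClosed.splits _)
    rw [(M ()).charpoly_natDegree_eq_dim, (M ()).charpoly_monic.leadingCoeff, one_pow,
      one_mul] at h
    rw [← h]
    simp only [p]
    rw [← resultant_map_map, ← derivative_map, ← Matrix.charpoly_map, hX]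
  have hsep : ∀ f : Polynomial Ω, f ≠ 0 →
      ((f.roots.map (derivative f).eval).prod ≠ 0 ↔ f.Separable) := by
    intro f hf
    rw [separable_def, isCoprime_iff_aeval_ne_zero_of_isAlgClosed Ω Ω]
    simp [Multiset.prod_eq_zero_iff, hf, or_iff_not_imp_left]
  let f : n ↪ Ω := (Fintype.equivFin n).toEmbedding.trans
    (Fin.valEmbedding.trans (Infinite.natEmbedding Ω))
  obtain ⟨r, hr⟩ := exists_eval_entries_ne_zero ρ hρ p (fun _ => diagonal f) (by
    refine (hp fun _ => diagonal f).trans_ne ?_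
    rw [hsep _ (charpoly_monic _).ne_zero, charpoly_diagonal, separable_prod_X_sub_C_iff]
    exact f.injective)
  replace hr := (hp fun i => ρ (r i)).symm.trans_ne hr
  rw [hsep _ (charpoly_monic _).ne_zero] at hr
  obtain ⟨φ, α, hα, h⟩ := exists_algEquiv_apply_eq_diagonal _ (nodup_roots hr)
  refine ⟨(φ.toAlgHom.restrictScalars K).comp ρ, r (), α, ?_, hα, h⟩
  have : Set.range ((φ.toAlgHom.restrictScalars K).comp ρ) = φ.toLinearMap '' Set.range ρ := by
    ext; simp
  rw [this, Submodule.span_image, hρ, Submodule.map_top, LinearMap.range_eq_top]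
  exact φ.surjective

theorem exists_conjugators {K Ω R ι n : Type*} [Field K] [Infinite K] [Field Ω]
    [Algebra K Ω] [Ring R] [Algebra K R] [Module.Finite K R] [Fintype n] [DecidableEq n]
    [Fintype ι] [DecidableEq ι]
    (ρ : R →ₐ[K] Matrix n n Ω) (hρ : Submodule.span Ω (Set.range ρ) = ⊤)
    (N : n → Ω) {i₀ i₁ : n} (hi : i₀ ≠ i₁) (hN : N i₁ ≠ 0) :
    ∃ g : ι → R, (∀ i, (ρ (g i)).det ≠ 0) ∧ ∀ i j k, i ≠ j → j ≠ k → i ≠ k →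
      ((ρ (g i))⁻¹ * ρ (g j) * diagonal N * (ρ (g j))⁻¹ * ρ (g k)) i₀ i₀ ≠ 0 := by
  classical
  have : Infinite Ω := Infinite.of_injective _ (algebraMap K Ω).injective
  let G : ι → Matrix n n (MvPolynomial (ι × n × n) Ω) :=
    fun i => Matrix.of fun a b => MvPolynomial.X (i, a, b)
  let W : ι → ι → ι → MvPolynomial (ι × n × n) Ω := fun i j k =>
    ((G i).adjugate * G j * (diagonal N).map MvPolynomial.C * (G j).adjugate * G k :
      Matrix n n (MvPolynomial (ι × n × n) Ω)) i₀ i₀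
  let ev : (ι → Matrix n n Ω) → MvPolynomial (ι × n × n) Ω →+* Ω :=
    fun M => MvPolynomial.eval (fun t => M t.1 t.2.1 t.2.2)
  have hG : ∀ M i, (ev M).mapMatrix (G i) = M i := by
    intro M i; ext a b; simp [G, ev]
  have hdet : ∀ M i, ev M (G i).det = (M i).det := by
    intro M i; rw [RingHom.map_det, hG]
  have hW : ∀ M i j k, ev M (W i j k) =
      ((M i).adjugate * M j * diagonal N * (M j).adjugate * M k) i₀ i₀ := by
    intro M i j k
    have hC : (ev M).mapMatrix ((diagonal N).map MvPolynomial.C) = diagonal N := by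
      ext a b; by_cases hab : a = b <;> simp [ev, hab]
    rw [← hC, ← hG M i, ← hG M j, ← hG M k, ← RingHom.map_adjugate, ← RingHom.map_adjugate,
      ← map_mul, ← map_mul, ← map_mul, ← map_mul]
    rfl
  let T : Finset (ι × ι × ι) :=
    Finset.univ.filter fun t => t.1 ≠ t.2.1 ∧ t.2.1 ≠ t.2.2 ∧ t.1 ≠ t.2.2
  let p := (∏ i, (G i).det) * ∏ t ∈ T, W t.1 t.2.1 t.2.2
  have hp : p ≠ 0 := by
    refine mul_ne_zero (Finset.prod_ne_zero_iff.mpr fun i _ h => ?_)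
      (Finset.prod_ne_zero_iff.mpr ?_)
    · simpa [h] using hdet (fun _ => 1) i
    · rintro ⟨i, j, k⟩ ht h
      simp only [T, Finset.mem_filter, Finset.mem_univ, true_and] at ht h
      let S : Matrix n n Ω := (Equiv.swap i₀ i₁).permMatrix Ω
      have hadj : S.adjugate = -S := by
        have hd : S.det = -1 := by simp [S, Matrix.det_permutation, hi]
        have hSS : S * S = 1 := by
          simp [S, ← Matrix.permMatrix_mul]
        calc S.adjugate = S.adjugate * (S * S) := by rw [hSS, mul_one]
          _ = -S := by rw [← mul_assoc, Matrix.adjugate_mul, hd]; simp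
      have := hW (fun l => if l = j then 1 else S) i j k
      rw [h, map_zero] at this
      simp only [ht.1, ht.2.1.symm, if_true, if_false, adjugate_one, mul_one, hadj] at this
      apply hN
      simpa [Matrix.mul_apply, S, Equiv.Perm.permMatrix, PEquiv.toMatrix_apply, diagonal_apply,
        Equiv.swap_apply_eq_iff] using this
  obtain ⟨x, hx⟩ : ∃ x, MvPolynomial.eval x p ≠ 0 := by
    by_contra! h
    exact hp (MvPolynomial.funext fun x => by simp [h])
  obtain ⟨g, hg⟩ := exists_eval_entries_ne_zero ρ hρ p (fun i a b => x (i, a, b)) hx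
  change ev (fun i => ρ (g i)) p ≠ 0 at hg
  simp only [p, map_mul, map_prod, mul_ne_zero_iff, Finset.prod_ne_zero_iff, hdet, hW] at hg
  refine ⟨g, fun i => hg.1 i (Finset.mem_univ _), fun i j k hij hjk hik h => ?_⟩
  refine hg.2 (i, j, k) (by simp [T, hij, hjk, hik]) ?_
  have hinv : ∀ l, (ρ (g l)).adjugate = (ρ (g l)).det • (ρ (g l))⁻¹ := by
    intro l
    rw [Matrix.inv_def, smul_smul, Ring.mul_inverse_cancel _ (hg.1 l (Finset.mem_univ _)).isUnit,
      one_smul]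
  simp only [hinv, Matrix.smul_mul, Matrix.mul_smul, Matrix.smul_apply, h, smul_zero]

theorem exists_integrallyClosed_ringHom_injective {k : Type*} [Field k]
    (hk : NotAlgebraicOverFiniteSubfield k) :
    ∃ (A : Type) (_ : CommRing A) (_ : IsDomain A) (f : A →+* k),
      IsIntegrallyClosed A ∧ Infinite A ∧ Finite Aˣ ∧ Function.Injective f := by
  obtain ⟨p, hp⟩ := CharP.exists k
  obtain hp' | rfl := CharP.char_is_prime_or_zero k p
  · have : Fact p.Prime := ⟨hp'⟩
    let _ : Algebra (ZMod p) k := ZMod.algebra k p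
    obtain ⟨x, hx⟩ : ∃ x : k, Transcendental (ZMod p) x := by
      by_contra! h
      refine hk ⟨(algebraMap (ZMod p) k).fieldRange, Set.finite_range _, fun x => ?_⟩
      obtain ⟨q, hq, hqx⟩ := not_not.mp (h x)
      let f : ZMod p →+* (algebraMap (ZMod p) k).fieldRange := (algebraMap (ZMod p) k).rangeRestrictField
      refine ⟨q.map f, (Polynomial.map_ne_zero_iff f.injective).mpr hq, ?_⟩
      rw [aeval_def, eval₂_map, ← hqx]
      rfl
    refine ⟨Polynomial (ZMod p), inferInstance, inferInstance, (aeval x).toRingHom, inferInstance,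
      inferInstance, ?_, transcendental_iff_injective.mp hx⟩
    refine Finite.of_surjective (Units.map (C : ZMod p →+* Polynomial (ZMod p)).toMonoidHom) fun u => ?_
    obtain ⟨r, hr, h⟩ := Polynomial.isUnit_iff.mp u.isUnit
    exact ⟨hr.unit, Units.ext (by simpa using h)⟩
  · have := CharP.charP_to_charZero k
    exact ⟨ℤ, inferInstance, inferInstance, Int.castRingHom k, inferInstance, inferInstance,
      inferInstance, Int.cast_injective⟩

theorem infinite_setOf_forall_sub_mul_ne_one {A F E : Type*} [CommRing A] [IsDomain A]
    [IsIntegrallyClosed A] [Infinite A] [Finite Aˣ] [Field F] [Algebra A F] [IsFractionRing A F]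
    [Field E] [Algebra F E] [Algebra A E] [IsScalarTower A F E] [FiniteDimensional F E]
    (B : Subalgebra A E) {s : A} (hs : s ≠ 0) (hB : ∀ x ∈ B, ∃ k : ℕ, IsIntegral A (s ^ k • x))
    {β : E} (hβB : β ∈ B) : {c : A | ∀ y ∈ B, (β - algebraMap A E c) * y ≠ 1}.Infinite := by
  intro hfin
  have hinjE : Function.Injective (algebraMap A E) := by
    rw [IsScalarTower.algebraMap_eq A F E]
    exact (algebraMap F E).injective.comp (IsFractionRing.injective A F)
  have hsE : algebraMap A E s ≠ 0 := (map_ne_zero_iff _ hinjE).mpr hs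
  obtain ⟨c₀, hc₀⟩ := hfin.infinite_compl.nonempty
  simp only [Set.mem_compl_iff, Set.mem_ofPred_eq, not_forall, not_not] at hc₀
  obtain ⟨δ, hδB, hδ⟩ := hc₀
  obtain ⟨M, hM⟩ := hB δ hδB
  have hδ0 : δ ≠ 0 := right_ne_zero_of_mul_eq_one hδ
  set γ : E := s ^ M • δ with hγ
  have hγ0 : algebraMap A E s * γ ≠ 0 := by
    rw [hγ, Algebra.smul_def, map_pow]
    exact mul_ne_zero hsE (mul_ne_zero (pow_ne_zero _ hsE) hδ0)
  have hunit : ∀ y : A, c₀ + s ^ (M + 1) * y ∉ {c : A | ∀ y ∈ B, (β - algebraMap A E c) * y ≠ 1} →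
      Algebra.norm F (1 - algebraMap A E (s * y) * γ) ∈
        Set.range (fun u : Aˣ => algebraMap A F u) := by
    intro y hy
    simp only [Set.mem_ofPred_eq, not_forall, not_not] at hy
    obtain ⟨z, hzB, hz⟩ := hy
    have hβ : β = algebraMap A E c₀ + δ⁻¹ := by
      field_simp; linear_combination hδ
    have hu : (1 - algebraMap A E (s * y) * γ) * (δ⁻¹ * z) = 1 := by
      calc (1 - algebraMap A E (s * y) * γ) * (δ⁻¹ * z)
          = (β - algebraMap A E (c₀ + s ^ (M + 1) * y)) * z := by
            rw [hβ, hγ, Algebra.smul_def]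
            simp only [map_add, map_mul, map_pow]
            field_simp
            ring
        _ = 1 := hz
    have hw : δ⁻¹ * z ∈ B := by
      have : δ⁻¹ = β - algebraMap A E c₀ := by rw [hβ]; ring
      rw [this]
      exact B.mul_mem (B.sub_mem hβB (B.algebraMap_mem c₀)) hzB
    obtain ⟨k, hk⟩ := hB _ hw
    have hint : IsIntegral A (1 - algebraMap A E (s * y) * γ) :=
      isIntegral_one.sub (isIntegral_algebraMap.mul hM)
    let u : integralClosure A E := ⟨_, hint⟩
    have hdvd : u ∣ algebraMap A (integralClosure A E) (s ^ k) := by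
      refine ⟨⟨_, hk⟩, Subtype.ext ?_⟩
      change algebraMap A E (s ^ k) = (1 - algebraMap A E (s * y) * γ) * (s ^ k • (δ⁻¹ * z))
      rw [mul_smul_comm, hu, Algebra.smul_def, mul_one]
    have hcop : IsCoprime u (algebraMap A (integralClosure A E) (s ^ k)) := by
      rw [map_pow]
      refine IsCoprime.pow_right ⟨1, algebraMap A _ y * ⟨γ, hM⟩, Subtype.ext ?_⟩
      change 1 * (1 - algebraMap A E (s * y) * γ) + algebraMap A E y * γ * algebraMap A E s = 1
      rw [map_mul]; ring
    obtain ⟨v, hv⟩ := isUnit_iff_exists_inv.mp (hcop.isUnit_of_dvd' dvd_rfl hdvd)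
    have hv' : (1 - algebraMap A E (s * y) * γ) * v = 1 := congrArg Subtype.val hv
    obtain ⟨a, ha⟩ := IsIntegrallyClosed.isIntegral_iff.mp (Algebra.isIntegral_norm F hint)
    obtain ⟨b, hb⟩ := IsIntegrallyClosed.isIntegral_iff.mp (Algebra.isIntegral_norm F v.2)
    have hab : a * b = 1 := IsFractionRing.injective A F (by
      rw [map_mul, ha, hb, ← map_mul, hv', map_one, map_one])
    exact ⟨Units.mkOfMulEqOne a b hab, ha⟩
  let η : E := (algebraMap A E s * γ)⁻¹
  let q : Polynomial F := (Algebra.lmul F E η).charpoly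
  have hq : ∀ y : A, Algebra.norm F (1 - algebraMap A E (s * y) * γ) =
      Algebra.norm F (-(algebraMap A E s * γ)) * q.eval (algebraMap A F y) := by
    intro y
    have h1 : (1 - algebraMap A E (s * y) * γ) =
        -(algebraMap A E s * γ) * (algebraMap F E (algebraMap A F y) - η) := by
      rw [← IsScalarTower.algebraMap_apply, neg_mul, mul_sub, mul_inv_cancel₀ hγ0, map_mul]; ring
    rw [h1, map_mul]
    congr 1
    rw [LinearMap.eval_charpoly, Algebra.norm_apply]
    congr 1
    ext z
    simp [Algebra.smul_def]
  have hq0 : ∀ v : F, q - C v ≠ 0 := by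
    intro v h
    have h1 : q.natDegree = 0 := by rw [sub_eq_zero.mp h, natDegree_C]
    rw [LinearMap.charpoly_natDegree] at h1
    exact Module.finrank_pos.ne' h1
  have hn0 : Algebra.norm F (-(algebraMap A E s * γ)) ≠ 0 :=
    Algebra.norm_ne_zero_iff.mpr (neg_ne_zero.mpr hγ0)
  have hinj : Function.Injective fun y : A => c₀ + s ^ (M + 1) * y := fun y₁ y₂ h =>
    mul_left_cancel₀ (pow_ne_zero _ hs) (add_left_cancel h)
  have hroots : Set.Finite {y : A | Algebra.norm F (1 - algebraMap A E (s * y) * γ) ∈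
        Set.range (fun u : Aˣ => algebraMap A F u)} := by
    refine Set.Finite.preimage' (Set.finite_range _) fun v _ => ?_
    refine Set.Finite.subset (Set.Finite.preimage (IsFractionRing.injective A F).injOn
      (Polynomial.finite_setOfPred_isRoot
        (hq0 ((Algebra.norm F (-(algebraMap A E s * γ)))⁻¹ * v)))) ?_
    rintro y rfl
    simp [-map_mul, hq, hn0]
  exact Set.infinite_univ ((hroots.union (hfin.preimage hinj.injOn)).subset fun y _ => by
    by_cases hy : c₀ + s ^ (M + 1) * y ∈ {c : A | ∀ y ∈ B, (β - algebraMap A E c) * y ≠ 1}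
    · exact Or.inr hy
    · exact Or.inl (hunit y hy))

theorem exists_field_finite_nonempty_algHom.{u, v} {A : Type u} {Ω : Type v} [CommRing A] [IsDomain A]
    [Field Ω] [Algebra A Ω] [FaithfulSMul A Ω] (S : Finset Ω) :
    ∃ (E : Type v) (_ : Field E) (_ : Algebra (FractionRing A) E) (_ : Algebra A E)
      (_ : IsScalarTower A (FractionRing A) E), FiniteDimensional (FractionRing A) E ∧
        Nonempty (Algebra.adjoin A (S : Set Ω) →ₐ[A] E) := by
  let _ : Algebra (FractionRing A) Ω := FractionRing.liftAlgebra A Ω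
  have : IsScalarTower A (FractionRing A) Ω := FractionRing.isScalarTower_liftAlgebra A Ω
  let C := Algebra.adjoin (FractionRing A) (S : Set Ω)
  have : Algebra.FiniteType (FractionRing A) C :=
    C.fg_iff_finiteType.mp (Subalgebra.fg_adjoin_finset S)
  obtain ⟨N, hN⟩ := Ideal.exists_maximal C
  let _ : Field (C ⧸ N) := Ideal.Quotient.field N
  have hle : Algebra.adjoin A (S : Set Ω) ≤ C.restrictScalars A :=
    Algebra.adjoin_le Algebra.subset_adjoin
  have : Algebra.FiniteType (FractionRing A) (C ⧸ N) :=
    Algebra.FiniteType.of_surjective (Ideal.Quotient.mkₐ (FractionRing A) N)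
      Ideal.Quotient.mk_surjective
  exact ⟨C ⧸ N, inferInstance, inferInstance, inferInstance, inferInstance,
    finite_of_finite_type_of_isJacobsonRing _ _,
    ⟨(Ideal.Quotient.mkₐ A N).comp (Subalgebra.inclusion hle : _ →ₐ[A] C)⟩⟩

theorem exists_ne_zero_forall_isIntegral_pow_smul {A E : Type*} [CommRing A] [IsDomain A]
    [CommRing E] [Algebra A E] [Algebra.IsAlgebraic A E] {B : Subalgebra A E} (hB : B.FG) :
    ∃ s : A, s ≠ 0 ∧ ∀ x ∈ B, ∃ k : ℕ, IsIntegral A (s ^ k • x) := by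
  obtain ⟨t, rfl⟩ := hB
  obtain ⟨s, hs, hst⟩ := Algebra.IsAlgebraic.exists_integral_multiples A t
  refine ⟨s, hs, fun x hx => ?_⟩
  induction hx using Algebra.adjoin_induction with
  | mem x hx => exact ⟨1, by simpa using hst x hx⟩
  | algebraMap r => exact ⟨0, by simpa using isIntegral_algebraMap⟩
  | add x y _ _ hx hy =>
    obtain ⟨k, hk⟩ := hx
    obtain ⟨l, hl⟩ := hy
    refine ⟨k + l, ?_⟩
    rw [smul_add]
    nth_rewrite 1 [add_comm k l]
    rw [pow_add, pow_add, mul_smul, mul_smul]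
    exact (hk.smul _).add (hl.smul _)
  | mul x y _ _ hx hy =>
    obtain ⟨k, hk⟩ := hx
    obtain ⟨l, hl⟩ := hy
    refine ⟨k + l, ?_⟩
    rw [pow_add, ← smul_mul_smul_comm]
    exact hk.mul hl

theorem exists_valuationSubring_sub_mem_nonunits {A Ω : Type*} [CommRing A] [IsDomain A]
    [IsIntegrallyClosed A] [Infinite A] [Finite Aˣ] [Field Ω] [Algebra A Ω] [FaithfulSMul A Ω]
    (S : Finset Ω) (β : Ω) {T : Set A} (hT : T.Finite) :
    ∃ c ∉ T, ∃ V : ValuationSubring Ω, (∀ x ∈ S, x ∈ V) ∧ β - algebraMap A Ω c ∈ V.nonunits := by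
  classical
  obtain ⟨E, _, _, _, _, _, ⟨φ⟩⟩ := exists_field_finite_nonempty_algHom (A := A) (insert β S)
  have : Algebra.IsAlgebraic A E := ⟨fun x =>
    (IsFractionRing.isAlgebraic_iff A (FractionRing A) E).mpr
      (IsIntegral.of_finite (FractionRing A) x).isAlgebraic⟩
  set B := Algebra.adjoin A ((insert β S : Finset Ω) : Set Ω) with hB
  have hβ : β ∈ B := Algebra.subset_adjoin (by simp)
  have : Algebra.FiniteType A B := B.fg_iff_finiteType.mp (Subalgebra.fg_adjoin_finset _)
  have hfg : φ.range.FG := by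
    rw [← Algebra.map_top]
    exact Subalgebra.FG.map φ Algebra.FiniteType.out
  obtain ⟨s, hs, hint⟩ := exists_ne_zero_forall_isIntegral_pow_smul hfg
  obtain ⟨c, hc, hcT⟩ := (infinite_setOf_forall_sub_mul_ne_one (F := FractionRing A) φ.range hs hint
    (φ.mem_range_self ⟨β, hβ⟩)).exists_notMem_finite hT
  let b : B := ⟨β, hβ⟩ - algebraMap A B c
  have hI : Ideal.span {b} ≠ ⊤ := by
    rw [Ne, Ideal.span_singleton_eq_top, isUnit_iff_exists_inv]
    rintro ⟨d, hd⟩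
    refine hc (φ d) (φ.mem_range_self d) ?_
    rw [← φ.commutes, ← map_sub, ← map_mul, hd, map_one]
  obtain ⟨V, hV, hIV⟩ := Ideal.image_subset_nonunits_valuationSubring (A := B.toSubring) _ hI
  exact ⟨c, hcT, V, fun x hx => hV (Algebra.subset_adjoin (by simp [hx])),
    hIV ⟨b, Ideal.mem_span_singleton_self b, rfl⟩⟩

theorem freeGroup_lift_injective_of_rank_one {α G V Ω κ n : Type*} [Group G] [CommRing V]
    [CommRing Ω] [Field κ] [Fintype n] [DecidableEq n] (f : α → G) (ρ : G →* Matrix n n Ω)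
    {ι : V →+* Ω} (hι : Function.Injective ι) (r : V →+* κ) {ϖ : V} (hϖ : r ϖ = 0)
    (M : α × Bool → Matrix n n V)
    (hM : ∀ s, (M s).map ι = ι ϖ • ρ (cond s.2 (f s.1) (f s.1)⁻¹))
    (v w : α × Bool → n → κ) (hvw : ∀ s, (M s).map r = vecMulVec (v s) (w s))
    (hne : ∀ s t, (s.1 = t.1 → s.2 = t.2) → w s ⬝ᵥ v t ≠ 0) :
    Function.Injective (FreeGroup.lift f) := by
  classical
  have hv : ∀ s, v s ≠ 0 := fun s h => hne s s (fun _ => rfl) (by simp [h])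
  have hw : ∀ s, w s ≠ 0 := fun s h => hne s s (fun _ => rfl) (by simp [h])
  have hres : ∀ (L : List (α × Bool)) (s : α × Bool), FreeGroup.IsReduced (s :: L) →
      ∃ u ≠ 0, (((s :: L).map M).prod).map r = vecMulVec (v s) u := by
    intro L
    induction L with
    | nil => exact fun s _ => ⟨w s, hw s, by simp [hvw]⟩
    | cons t L ih =>
      intro s hs
      obtain ⟨hst, hL⟩ := List.isChain_cons_cons.mp hs
      obtain ⟨u, hu, h⟩ := ih t hL
      refine ⟨(w s ⬝ᵥ v t) • u, smul_ne_zero (hne s t hst) hu, ?_⟩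
      rw [List.map_cons, List.prod_cons, Matrix.map_mul, h, hvw, vecMulVec_mul_vecMulVec]
  have hlift : ∀ L : List (α × Bool), ((L.map M).prod).map ι =
      (ι ϖ) ^ L.length • ρ (FreeGroup.lift f (FreeGroup.mk L)) := by
    intro L
    induction L with
    | nil => simp
    | cons s L ih =>
      rw [FreeGroup.lift_mk] at ih ⊢
      simp only [List.map_cons, List.prod_cons, Matrix.map_mul, ih, hM, List.length_cons, pow_succ',
        map_mul, smul_mul_smul_comm]
  rw [injective_iff_map_eq_one]
  intro g hg
  by_contra hg1
  obtain ⟨s, L, hL⟩ := List.exists_cons_of_ne_nil (mt FreeGroup.toWord_eq_nil_iff.mp hg1)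
  obtain ⟨u, hu, h⟩ := hres L s (hL ▸ FreeGroup.isReduced_toWord)
  have h1 := hlift (s :: L)
  rw [← hL, FreeGroup.mk_toWord, hg, map_one, hL] at h1
  have h2 : ((s :: L).map M).prod = ϖ ^ (s :: L).length • (1 : Matrix n n V) := by
    refine Matrix.map_injective hι (h1.trans ?_)
    ext a b
    by_cases hab : a = b <;> simp [hab]
  rw [h2] at h
  obtain ⟨a, ha⟩ := Function.ne_iff.mp (hv s)
  obtain ⟨b, hb⟩ := Function.ne_iff.mp hu
  have := congrFun₂ h a b
  simp [hϖ, vecMulVec_apply] at this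
  tauto

theorem freeGroup_lift_injective_of_conjugates {G V Ω κ n : Type*} [Group G] [CommRing V]
    [CommRing Ω] [Field κ] [Fintype n] [DecidableEq n] (ρ : G →* Matrix n n Ω)
    {ι : V →+* Ω} (hι : Function.Injective ι) (r : V →+* κ) (P : Bool × Fin 4 → G)
    (γ γ' : Bool × Fin 4 → Matrix n n V) (hγ : ∀ i, γ' i * γ i = 1) {d d' : n → V} {π : V}
    (hd : ∀ t, d t * d' t = π) (hπ : r π = 0) {i₀ : n} (hd' : ∀ t, r (d' t) = if t = i₀ then 1 else 0)
    (hP : ∀ i, ρ (P i) = (γ i * diagonal d * γ' i).map ι)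
    (hne : ∀ i j k, i ≠ j → j ≠ k → i ≠ k →
      r ((γ' i * γ j * diagonal d * γ' j * γ k) i₀ i₀) ≠ 0) :
    Function.Injective (FreeGroup.lift fun b : Bool =>
      P (b, 0) * (P (b, 1))⁻¹ * P (b, 2) * (P (b, 3))⁻¹) := by
  let p i := γ i * diagonal d * γ' i
  let q i := γ i * diagonal d' * γ' i
  let u i := (γ i).map r |>.col i₀
  let φ i := (γ' i).map r |>.row i₀
  have hpq : ∀ i, p i * q i = π • 1 := by
    intro i
    have hγ' : γ i * γ' i = 1 := mul_eq_one_comm.mp (hγ i)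
    calc p i * q i = γ i * (diagonal d * (γ' i * γ i) * diagonal d') * γ' i := by
          simp only [p, q, mul_assoc]
      _ = γ i * (π • 1) * γ' i := by
          rw [hγ, mul_one, diagonal_mul_diagonal, funext hd, smul_one_eq_diagonal]
      _ = π • 1 := by rw [mul_smul_comm, mul_one, smul_mul_assoc, hγ']
  have hq : ∀ i, (q i).map ι = ι π • ρ (P i)⁻¹ := by
    intro i
    calc (q i).map ι = ρ (P i)⁻¹ * (ρ (P i) * (q i).map ι) := by
          rw [← mul_assoc, ← map_mul, inv_mul_cancel, map_one, one_mul]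
      _ = ι π • ρ (P i)⁻¹ := by
          rw [hP, ← Matrix.map_mul, hpq]
          ext a b
          simp [smul_one_eq_diagonal, mul_comm]
  have hqr : ∀ i, (q i).map r = vecMulVec (u i) (φ i) := by
    intro i
    ext a b
    simp [q, u, φ, Matrix.mul_apply, diagonal_apply, hd', vecMulVec_apply]
  have hp : ∀ i, (p i).map ι = ρ (P i) := fun i => (hP i).symm
  have hφ : ∀ i j k, φ i ⬝ᵥ (p j).map r *ᵥ u k = r ((γ' i * γ j * diagonal d * γ' j * γ k) i₀ i₀) := by
    intro i j k
    have : (γ' i * γ j * diagonal d * γ' j * γ k) = γ' i * (p j * γ k) := by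
      simp only [p, mul_assoc]
    rw [this, ← Matrix.map_apply (f := r)]
    simp only [Matrix.map_mul]
    rfl
  let e : Bool × Bool → Fin 4 → Bool × Fin 4 := fun s l => (s.1, cond s.2 l l.rev)
  refine freeGroup_lift_injective_of_rank_one _ ρ hι r (ϖ := π ^ 2) (by simp [hπ])
    (fun s => p (e s 0) * q (e s 1) * p (e s 2) * q (e s 3)) ?_
    (fun s => (φ (e s 1) ⬝ᵥ (p (e s 2)).map r *ᵥ u (e s 3)) • (p (e s 0)).map r *ᵥ u (e s 1))
    (fun s => φ (e s 3)) ?_ ?_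
  · rintro ⟨b, _ | _⟩
    all_goals
      simp only [e, Matrix.map_mul, hp, hq, cond_true, cond_false, mul_smul_comm, smul_mul_assoc,
        smul_smul, pow_two, map_mul, _root_.mul_inv_rev, inv_inv, mul_assoc]
    rfl
  · intro s
    simp only [Matrix.map_mul, hqr]
    rw [mul_assoc, mul_assoc, Matrix.mul_vecMulVec, vecMulVec_mul_vecMulVec,
      Matrix.mul_vecMulVec, vecMulVec_smul, smul_vecMulVec]
  · intro s t hst
    rw [dotProduct_smul, hφ, hφ]
    refine mul_ne_zero (hne _ _ _ ?_ ?_ ?_) (hne _ _ _ ?_ ?_ ?_) <;> revert s t <;> decide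

theorem freeGroup_lift_injective_of_valuationSubring {G Ω n : Type*} [Group G] [Field Ω]
    [Fintype n] [DecidableEq n] (ρ : G →* Matrix n n Ω) (V : ValuationSubring Ω)
    (P : Bool × Fin 4 → G) {Γ : Bool × Fin 4 → Matrix n n Ω} (hdet : ∀ i, (Γ i).det ≠ 0)
    (hΓ : ∀ i a b, Γ i a b ∈ V) (hΓ' : ∀ i a b, (Γ i)⁻¹ a b ∈ V) {η : n → Ω} {i₀ : n}
    (hη₀ : η i₀ = 0) (hη : ∀ t ≠ i₀, η t ≠ 0) (hηV : ∀ t, η t ∈ V) (hηV' : ∀ t, (η t)⁻¹ ∈ V)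
    {π : Ω} (hπ : π ∈ V.nonunits)
    (hP : ∀ i, ρ (P i) = Γ i * diagonal (fun t => η t + π) * (Γ i)⁻¹)
    (hne : ∀ i j k, i ≠ j → j ≠ k → i ≠ k →
      ((Γ i)⁻¹ * Γ j * diagonal η * (Γ j)⁻¹ * Γ k) i₀ i₀ ≠ 0)
    (hneV : ∀ i j k, (((Γ i)⁻¹ * Γ j * diagonal η * (Γ j)⁻¹ * Γ k) i₀ i₀)⁻¹ ∈ V) :
    Function.Injective (FreeGroup.lift fun b : Bool =>
      P (b, 0) * (P (b, 1))⁻¹ * P (b, 2) * (P (b, 3))⁻¹) := by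
  obtain ⟨hπV, hπm⟩ := V.mem_nonunits_iff_exists_mem_maximalIdeal.mp hπ
  lift π to V using hπV
  let ι : V →+* Ω := V.subtype
  have hι : Function.Injective ι := Subtype.val_injective
  let r : V →+* IsLocalRing.ResidueField V := IsLocalRing.residue V
  have hrπ : r π = 0 := (IsLocalRing.residue_eq_zero_iff π).mpr hπm
  let γ : Bool × Fin 4 → Matrix n n V := fun i => Matrix.of fun a b => ⟨Γ i a b, hΓ i a b⟩
  let γ' : Bool × Fin 4 → Matrix n n V := fun i => Matrix.of fun a b => ⟨(Γ i)⁻¹ a b, hΓ' i a b⟩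
  let e : n → V := fun t => ⟨η t, hηV t⟩
  let d : n → V := fun t => e t + π
  have hγι : ∀ i, (γ i).map ι = Γ i := fun i => rfl
  have hγι' : ∀ i, (γ' i).map ι = (Γ i)⁻¹ := fun i => rfl
  have hunit : ∀ x : V, (x : Ω) ≠ 0 → (x : Ω)⁻¹ ∈ V → r x ≠ 0 := by
    intro x hx hxV
    rw [Ne, IsLocalRing.residue_eq_zero_iff, IsLocalRing.mem_maximalIdeal, mem_nonunits_iff, not_not]
    exact IsUnit.of_mul_eq_one ⟨_, hxV⟩ (Subtype.ext (mul_inv_cancel₀ hx))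
  have hd : ∀ t ≠ i₀, IsUnit (d t) := by
    intro t ht
    rw [← IsLocalRing.residue_ne_zero_iff_isUnit]
    change r (e t + π) ≠ 0
    rw [map_add, hrπ, add_zero]
    exact hunit _ (hη t ht) (hηV' t)
  refine freeGroup_lift_injective_of_conjugates ρ hι r P γ γ' ?_ (d := d)
    (d' := fun t => if t = i₀ then 1 else π * Ring.inverse (d t)) (π := π) ?_ hrπ (i₀ := i₀) ?_ ?_ ?_
  · intro i
    refine Matrix.map_injective hι ?_
    beta_reduce
    rw [Matrix.map_mul, hγι, hγι', Matrix.nonsing_inv_mul _ (hdet i).isUnit,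
      Matrix.map_one _ (map_zero _) (map_one _)]
  · intro t
    split_ifs with ht
    · have : e t = 0 := Subtype.ext (ht ▸ hη₀)
      simp [d, this]
    · rw [mul_left_comm, Ring.mul_inverse_cancel _ (hd t ht), mul_one]
  · intro t
    split_ifs with ht <;> simp [hrπ]
  · intro i
    rw [Matrix.map_mul, Matrix.map_mul, hγι, hγι', hP, diagonal_map (map_zero _)]
    rfl
  · intro i j k hij hjk hik
    have hde : (diagonal d).map r = (diagonal e).map r := by
      rw [diagonal_map (map_zero _), diagonal_map (map_zero _)]
      congr 1; ext t
      simp [d, hrπ]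
    have h1 : r ((γ' i * γ j * diagonal d * γ' j * γ k) i₀ i₀) =
        r ((γ' i * γ j * diagonal e * γ' j * γ k) i₀ i₀) := by
      rw [← Matrix.map_apply (f := r), ← Matrix.map_apply (f := r)]
      simp only [Matrix.map_mul, hde]
    have h2 : (((γ' i * γ j * diagonal e * γ' j * γ k) i₀ i₀ : V) : Ω) =
        ((Γ i)⁻¹ * Γ j * diagonal η * (Γ j)⁻¹ * Γ k) i₀ i₀ := by
      change ((γ' i * γ j * diagonal e * γ' j * γ k).map ι) i₀ i₀ = _
      simp only [Matrix.map_mul, hγι, hγι', diagonal_map (map_zero ι)]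
      rfl
    rw [h1]
    exact hunit _ (h2 ▸ hne i j k hij hjk hik) (h2 ▸ hneV i j k)

theorem isUnit_of_det_ne_zero {K Ω R n : Type*} [Field K] [Field Ω] [Algebra K Ω] [Ring R]
    [Algebra K R] [Module.Finite K R] [Fintype n] [DecidableEq n] {ρ : R →ₐ[K] Matrix n n Ω}
    (hρ : Function.Injective ρ) {x : R} (hx : (ρ x).det ≠ 0) : IsUnit x := by
  have hinj : Function.Injective (LinearMap.mulLeft K x) := by
    rw [injective_iff_map_eq_zero]
    intro y hy
    refine (map_eq_zero_iff ρ hρ).mp ?_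
    have h : ρ x * ρ y = 0 := by rw [← map_mul]; exact (map_eq_zero_iff ρ hρ).mpr hy
    rw [← one_mul (ρ y), ← Matrix.nonsing_inv_mul _ hx.isUnit, mul_assoc, h, mul_zero]
  obtain ⟨y, hy⟩ := LinearMap.injective_iff_surjective.mp hinj 1
  have hy : x * y = 1 := hy
  refine ⟨⟨x, y, hy, hρ ?_⟩, rfl⟩
  rw [map_mul, map_one, mul_eq_one_comm, ← map_mul, hy, map_one]

theorem hasFreeNoncyclicSubgroup_of_lift_injective {G : Type*} [Group G] {f : Bool → G}
    (hf : Function.Injective (FreeGroup.lift f)) : HasFreeNoncyclicSubgroup G := by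
  have h : (fun b : Bool => if b then f true else f false) = f := by
    ext b; cases b <;> rfl
  exact ⟨f true, f false, h.symm ▸ hf⟩

/-- If `k` is a field not algebraic over a finite subfield, `K` is a field
extension of `k`, and `R` is a noncommutative central simple `K`-algebra
finite dimensional over `K`, then the group of units of `R` contains a free
noncyclic subgroup. -/
theorem central_simple_has_free_subgroup
    {k K R : Type*} [Field k] [Field K] [Algebra k K]
    (hk : NotAlgebraicOverFiniteSubfield k)
    [Ring R] [Algebra K R] [IsSimpleRing R] [Algebra.IsCentral K R]
    [Module.Finite K R] (hnc : ¬ ∀ a b : R, a * b = b * a) :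
    HasFreeNoncyclicSubgroup Rˣ := by
  obtain ⟨A, _, _, f, _, _, _, hf⟩ := exists_integrallyClosed_ringHom_injective hk
  let Ω := AlgebraicClosure K
  let fK : A →+* K := (algebraMap k K).comp f
  have hfK : Function.Injective fK := (algebraMap k K).injective.comp hf
  have : Infinite K := Infinite.of_injective fK hfK
  let _ : Algebra A Ω := ((algebraMap K Ω).comp fK).toAlgebra
  have hAΩ : ∀ c, algebraMap A Ω c = algebraMap K Ω (fK c) := fun _ => rfl
  have hinj : Function.Injective (algebraMap A Ω) := (algebraMap K Ω).injective.comp hfK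
  have : FaithfulSMul A Ω := (faithfulSMul_iff_algebraMap_injective A Ω).mpr hinj
  obtain ⟨n, ρ₀, hn, hρ₀⟩ := exists_algHom_matrix_span_eq_top K Ω R
  obtain ⟨ρ, a, α, hρ, hα, ha⟩ := exists_algHom_apply_eq_diagonal ρ₀ hρ₀
  have : NeZero n := ⟨hn⟩
  have hρinj : Function.Injective ρ := ρ.toRingHom.injective
  have : Nontrivial (Fin n) := by
    by_contra h
    rw [not_nontrivial_iff_subsingleton] at h
    refine hnc fun x y => hρinj ?_
    ext i j
    obtain rfl := Subsingleton.elim i j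
    simp [Matrix.mul_apply, Fintype.sum_subsingleton _ i, mul_comm]
  obtain ⟨i₀, i₁, hi⟩ := exists_pair_ne (Fin n)
  let η : Fin n → Ω := fun t => α t - α i₀
  have hη : ∀ t ≠ i₀, η t ≠ 0 := fun t ht => sub_ne_zero.mpr (hα.ne ht)
  obtain ⟨g, hg, hgne⟩ := exists_conjugators (ι := Bool × Fin 4) ρ hρ η hi (hη i₁ hi.symm)
  let Γ : Bool × Fin 4 → Matrix (Fin n) (Fin n) Ω := fun i => ρ (g i)
  have hfin : ((Set.range fun x : (Bool × Fin 4) × Fin n × Fin n => Γ x.1 x.2.1 x.2.2) ∪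
    (Set.range fun x : (Bool × Fin 4) × Fin n × Fin n => (Γ x.1)⁻¹ x.2.1 x.2.2) ∪
    Set.range η ∪ (Set.range fun t => (η t)⁻¹) ∪
    (Set.range fun x : (Bool × Fin 4) × (Bool × Fin 4) × (Bool × Fin 4) =>
      (((Γ x.1)⁻¹ * Γ x.2.1 * diagonal η * (Γ x.2.1)⁻¹ * Γ x.2.2) i₀ i₀)⁻¹)).Finite :=
    Set.toFinite _
  have hT : (algebraMap A Ω ⁻¹' Set.range α).Finite :=
    (Set.finite_range α).preimage hinj.injOn
  obtain ⟨c, hc, V, hV, hcV⟩ := exists_valuationSubring_sub_mem_nonunits hfin.toFinset (α i₀) hT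
  simp only [Set.Finite.mem_toFinset] at hV
  let b : R := a - algebraMap K R (fK c)
  have hb : ρ b = diagonal fun t => η t + (α i₀ - algebraMap A Ω c) := by
    rw [map_sub, ha, AlgHom.commutes, Matrix.algebraMap_eq_diagonal, diagonal_sub]
    congr 1; ext t
    simp [η, hAΩ]
  have hbu : IsUnit b := by
    refine isUnit_of_det_ne_zero hρinj ?_
    rw [hb, det_diagonal, Finset.prod_ne_zero_iff]
    intro t _ h
    exact hc ⟨t, by linear_combination h⟩
  have hgu : ∀ i, IsUnit (g i) := fun i => isUnit_of_det_ne_zero hρinj (hg i)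
  let P : Bool × Fin 4 → Rˣ := fun i => (hgu i).unit * hbu.unit * (hgu i).unit⁻¹
  let σ : Rˣ →* Matrix (Fin n) (Fin n) Ω := (ρ : R →* Matrix (Fin n) (Fin n) Ω).comp (Units.coeHom R)
  have hP : ∀ i, σ (P i) = Γ i * diagonal (fun t => η t + (α i₀ - algebraMap A Ω c)) * (Γ i)⁻¹ := by
    intro i
    have h : σ (hgu i).unit⁻¹ = (Γ i)⁻¹ := by
      refine (Matrix.inv_eq_left_inv ?_).symm
      change σ _ * σ (hgu i).unit = 1
      rw [← map_mul, inv_mul_cancel, map_one]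
    rw [map_mul, map_mul, h, ← hb]
    rfl
  exact hasFreeNoncyclicSubgroup_of_lift_injective <| freeGroup_lift_injective_of_valuationSubring σ V P hg
    (fun i x y => hV _ (by left; left; left; left; exact ⟨(i, x, y), rfl⟩))
    (fun i x y => hV _ (by left; left; left; right; exact ⟨(i, x, y), rfl⟩))
    (sub_self (α i₀)) hη (fun t => hV _ (by left; left; right; exact ⟨t, rfl⟩))
    (fun t => hV _ (by left; right; exact ⟨t, rfl⟩)) hcV hP hgne
    (fun i j l => hV _ (by right; exact ⟨(i, j, l), rfl⟩))
end
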